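/- Let c = (c_1,…,c_m) be a cardinality sequence with m ≥ 2 and 2 ≤ c_1 < ⋯ < c_m ≤ n. Let αx ≤ α_0 be a facet defining inequality for the cardinality constrained path polytope P_{0,n-path}^c(D̃_n), and let γ be the maximum of Σ_{(i,j)∈C} α_{ij} over all simple directed cycles C in D̃_n (equivalently, simple directed cycles on the internal nodes {1,…,n−1}) with |C| = c_p for some p. Define α_{ni} := α_{0i} for i = 1,…,n−1. Then the inequality Σ_{i=1}^n Σ_{j≠i, j=1}^n α_{ij} x_{ij} + (γ − α_0)·x(δ^out(n)) ≤ γ defines a facet of the cardinality constrained cycle polytope P_C^c(D_n), where D_n is the complete digraph on node set {1,…,n}. -/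

import Mathlib

open Finset

/-- The arc set `Ã_n` of the digraph `D̃_n` on the node set `Ñ_n = {0,1,…,n} = Fin (n+1)`:
all arcs `(i,j)` with `i ≠ j`, except those entering `0`, those leaving `n`, and the arc
`(0,n)`.  This is exactly
`{(0,i),(i,n) : 1 ≤ i ≤ n-1} ∪ {(i,j) : 1 ≤ i,j ≤ n-1, i ≠ j}`. -/
def tA (n : ℕ) : Finset (Fin (n + 1) × Fin (n + 1)) :=
  Finset.univ.filter (fun a => a.1 ≠ a.2 ∧ a.2 ≠ 0 ∧ a.1 ≠ Fin.last n ∧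
    ¬(a.1 = 0 ∧ a.2 = Fin.last n))

/-- A simple directed `(0,n)`-path in `D̃_n`, encoded by its arc set: there is an
injective map `f` from `Fin (k+1)` to the nodes with `f 0 = 0` and `f k = n` whose
consecutive pairs are exactly the arcs of `P` (so `P` has `k` arcs). -/
def IsTildePath (n : ℕ) (P : Finset (Fin (n + 1) × Fin (n + 1))) : Prop :=
  P ⊆ tA n ∧ ∃ (k : ℕ) (f : Fin (k + 1) → Fin (n + 1)), Function.Injective f ∧
    f 0 = 0 ∧ f (Fin.last k) = Fin.last n ∧
    P = Finset.image (fun i : Fin k => (f (Fin.castSucc i), f (Fin.succ i))) Finset.univ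

/-- Incidence vector of an arc set. -/
noncomputable def incVec {N : ℕ} (C : Finset (Fin N × Fin N)) : Fin N → Fin N → ℝ :=
  fun i j => if (i, j) ∈ C then 1 else 0

/-- The cardinality constrained path polytope `P_{0,n-path}^c(D̃_n)`: the convex hull of
the incidence vectors of simple `(0,n)`-paths whose cardinality is `c p` for some `p`. -/
noncomputable def pathPolytope (n : ℕ) {m : ℕ} (c : Fin m → ℕ) :
    Set (Fin (n + 1) → Fin (n + 1) → ℝ) :=
  convexHull ℝ {x | ∃ P, IsTildePath n P ∧ (∃ p, P.card = c p) ∧ x = incVec P}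

/-- `x(δ^out(i))` in `D̃_n`. -/
noncomputable def outT (n : ℕ) (x : Fin (n + 1) → Fin (n + 1) → ℝ) (i : Fin (n + 1)) :
    ℝ :=
  ∑ a ∈ (tA n).filter (fun a => a.1 = i), x a.1 a.2

/-- `x(δ^in(i))` in `D̃_n`. -/
noncomputable def inT (n : ℕ) (x : Fin (n + 1) → Fin (n + 1) → ℝ) (i : Fin (n + 1)) :
    ℝ :=
  ∑ a ∈ (tA n).filter (fun a => a.2 = i), x a.1 a.2

/-- The dimension (of the affine hull) of a subset of a real vector space. -/
noncomputable def adim {V : Type*} [AddCommGroup V] [Module ℝ V] (P : Set V) : ℕ :=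
  Module.finrank ℝ (vectorSpan ℝ P)

/-- The valid inequality `f x ≤ b` defines a facet of `P`: it is valid and its face has
dimension `(dim P) - 1`. -/
def IsFacetLE {V : Type*} [AddCommGroup V] [Module ℝ V] (P : Set V) (f : V → ℝ) (b : ℝ) :
    Prop :=
  (∀ x ∈ P, f x ≤ b) ∧ adim {x ∈ P | f x = b} + 1 = adim P

/-- The valid inequality `f x ≥ b` defines a facet of `P`: it is valid and its face has
dimension `(dim P) - 1`. -/
def IsFacetGE {V : Type*} [AddCommGroup V] [Module ℝ V] (P : Set V) (f : V → ℝ) (b : ℝ) :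
    Prop :=
  (∀ x ∈ P, b ≤ f x) ∧ adim {x ∈ P | f x = b} + 1 = adim P

/-- A simple directed cycle on the node set `Fin N`, encoded by its arc set. -/
def IsSimpleCycle {N : ℕ} (C : Finset (Fin N × Fin N)) : Prop :=
  ∃ (k : ℕ) (f : Fin (k + 2) → Fin N), Function.Injective f ∧
    C = Finset.image (fun i : Fin (k + 2) => (f i, f (i + 1))) Finset.univ

/-- The cardinality constrained cycle polytope `P_C^c(D_n)` of the complete digraph `D_n`
on the node set `{1,…,n} = Fin (n+1) \ {0}`: the convex hull of the incidence vectors of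
simple directed cycles avoiding node `0` whose cardinality is `c p` for some `p`. -/
noncomputable def cyclePolytopeOn (n : ℕ) {m : ℕ} (c : Fin m → ℕ) :
    Set (Fin (n + 1) → Fin (n + 1) → ℝ) :=
  convexHull ℝ {x | ∃ C : Finset (Fin (n + 1) × Fin (n + 1)), IsSimpleCycle C ∧
    (∀ a ∈ C, a.1 ≠ 0 ∧ a.2 ≠ 0) ∧ (∃ p, C.card = c p) ∧ x = incVec C}


section CyclicallyBalanced

variable {N : Type*}

theorem exists_injective_extension [Fintype N] {j k : ℕ} (hjk : j ≤ k)
    (hk : k ≤ Fintype.card N) (u : Fin j → N) (hu : Function.Injective u) :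
    ∃ v : Fin k → N, Function.Injective v ∧ ∀ i : Fin j, v (Fin.castLE hjk i) = u i := by
  induction k, hjk using Nat.le_induction with
  | base => exact ⟨u, hu, fun i => rfl⟩
  | succ k hjk ih =>
    obtain ⟨v, hv, hvu⟩ := ih (by omega)
    obtain ⟨x, hx⟩ : ∃ x, ∀ i, v i ≠ x := by
      by_contra! h
      have := Fintype.card_le_of_surjective v h
      simp at this
      omega
    refine ⟨Fin.snoc v x, ?_, fun i => ?_⟩
    · rw [Fin.snoc_injective_iff]
      exact ⟨hv, fun ⟨i, hi⟩ => hx i hi⟩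
    · rw [← hvu i, ← Fin.castSucc_castLE hjk, Fin.snoc_castSucc]

/-- Along every closed walk on `k + 1` distinct nodes, each arc has `G`-weight equal to the total
of `G` over the arcs plus the total of `t` over the nodes. -/
def CyclicallyBalanced (G : N → N → ℝ) (t : N → ℝ) (k : ℕ) : Prop :=
  ∀ v : Fin (k + 1) → N, Function.Injective v → ∀ r,
    G (v r) (v (r + 1)) = ∑ i, (G (v i) (v (i + 1)) + t (v i))

theorem CyclicallyBalanced.sum_eq {G : N → N → ℝ} {t : N → ℝ} {k : ℕ}
    (h : CyclicallyBalanced G t k) {v : Fin (k + 1) → N} (hv : Function.Injective v)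
    (r : Fin (k + 1)) : ∑ i, t (v i) = -(k * G (v r) (v (r + 1))) := by
  have h1 := h v hv r
  have h2 : ∀ i, G (v i) (v (i + 1)) = G (v r) (v (r + 1)) := fun i => by
    rw [h v hv i, h v hv r]
  rw [sum_add_distrib, sum_congr rfl fun i _ => h2 i] at h1
  simp at h1
  linarith

theorem CyclicallyBalanced.apply_eq [Fintype N] {G : N → N → ℝ} {t : N → ℝ} {k : ℕ}
    (h : CyclicallyBalanced G t (k + 2)) (hk : k + 3 ≤ Fintype.card N) {u v x : N}
    (huv : u ≠ v) (hux : u ≠ x) (hvx : v ≠ x) : G u v = G v x := by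
  obtain ⟨z, hz, hzu⟩ := exists_injective_extension (j := 3) (by omega) hk ![u, v, x] (by
    intro i j; fin_cases i <;> fin_cases j <;> simp [huv, hux, hvx, huv.symm, hux.symm, hvx.symm])
  have h0 : z 0 = u := hzu 0
  have h1 : z (0 + 1) = v := hzu 1
  have h2 : z (0 + 1 + 1) = x := by
    rw [← show _ = x from hzu 2]
    congr 1
  have := (h z hz 0).trans (h z hz (0 + 1)).symm
  rwa [h0, h1, h2] at this

theorem injective_pair {u v : N} (huv : u ≠ v) : Function.Injective ![u, v] := by
  intro i j; fin_cases i <;> fin_cases j <;> simp [huv, huv.symm]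

/-- Swapping one node of a sequence that does not cover everything. -/
theorem eq_of_sum_eq [Fintype N] {t : N → ℝ} {k : ℕ} {s : ℝ} (hk : k + 1 < Fintype.card N)
    (h : ∀ v : Fin (k + 1) → N, Function.Injective v → ∑ i, t (v i) = s) (x y : N) :
    t x = t y := by
  by_cases hxy : x = y
  · rw [hxy]
  obtain ⟨z, hz, hzu⟩ := exists_injective_extension (j := 2) (k := k + 2) (by omega) hk
    ![x, y] (injective_pair hxy)
  have h0 : z 0 = x := hzu 0
  have h1 : z 1 = y := hzu 1
  have e1 := h (z ∘ Fin.succ) (hz.comp (Fin.succ_injective _))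
  have e2 := h (z ∘ Fin.succAbove 1) (hz.comp Fin.succAbove_right_injective)
  rw [Fin.sum_univ_succ] at e1 e2
  simp [h0, h1] at e1 e2
  linarith

theorem CyclicallyBalanced.eq_zero [Fintype N] {G : N → N → ℝ} {t : N → ℝ} {k l : ℕ}
    (hk : CyclicallyBalanced G t k) (hl : CyclicallyBalanced G t l) (hkl : k < l)
    (hlN : l < Fintype.card N) : (∀ x, t x = 0) ∧ ∀ u v, u ≠ v → G u v = 0 := by
  rcases Nat.eq_zero_or_pos k with rfl | hk0
  · have ht : ∀ x, t x = 0 := fun x => by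
      simpa using hk.sum_eq (v := fun _ => x)
        (fun a b _ => Subsingleton.elim (α := Fin 1) a b) 0
    refine ⟨ht, fun u v huv => ?_⟩
    obtain ⟨z, hz, hzu⟩ := exists_injective_extension (j := 2) (k := l + 1) (by omega) hlN
      ![u, v] (injective_pair huv)
    have h0 : z 0 = u := hzu 0
    have h1 : z (0 + 1) = v := by
      rw [← show _ = v from hzu 1]
      congr 1
      ext
      simp [Nat.mod_eq_of_lt, hkl]
    have := hl.sum_eq hz 0
    simp only [ht, h0, h1, sum_const_zero] at this
    have hl0 : (l : ℝ) ≠ 0 := by positivity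
    simpa [hl0] using this.symm
  · obtain ⟨k, rfl⟩ : ∃ k', k = k' + 1 := ⟨k - 1, by omega⟩
    obtain ⟨l, rfl⟩ : ∃ l', l = l' + 2 := ⟨l - 2, by omega⟩
    have third : ∀ u v : N, ∃ x, u ≠ x ∧ v ≠ x := fun u v => by
      classical
      obtain ⟨x, hx⟩ := exists_mem_notMem_of_card_lt_card (s := {u, v}) (t := univ)
        (by have := card_le_two (a := u) (b := v); rw [card_univ]; omega)
      simp at hx
      exact ⟨x, fun h => hx.1 h.symm, fun h => hx.2 h.symm⟩
    have hout : ∀ v x y, v ≠ x → v ≠ y → G v x = G v y := by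
      intro v x y hvx hvy
      by_cases hxy : x = y
      · rw [hxy]
      rcases Nat.eq_zero_or_pos k with rfl | hk0
      · have := (hk ![v, x] (injective_pair hvx) 0).trans (hk ![v, x] (injective_pair hvx) 1).symm
        simp at this
        rw [this]
        exact hl.apply_eq hlN hvx.symm hxy hvy
      · classical
        obtain ⟨u, hu⟩ := exists_mem_notMem_of_card_lt_card (s := {v, x, y}) (t := univ)
          (by have := card_le_three (a := v) (b := x) (c := y); rw [card_univ]; omega)
        simp at hu
        rw [← hl.apply_eq hlN hu.1 hu.2.1 hvx, hl.apply_eq hlN hu.1 hu.2.2 hvy]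
    obtain ⟨c, hc⟩ : ∃ c, ∀ u v, u ≠ v → G u v = c := by
      have : 0 < Fintype.card N := by omega
      obtain ⟨o⟩ := Fintype.card_pos_iff.1 this
      obtain ⟨p, hp, -⟩ := third o o
      refine ⟨G o p, fun u v huv => ?_⟩
      by_cases huo : u = o
      · subst huo; exact hout _ _ _ huv hp
      · obtain ⟨x, hx, hx'⟩ := third u o
        rw [hout u v o huv huo, hl.apply_eq hlN huo hx hx', hout o x p hx' hp]
    have hs : ∀ {k}, CyclicallyBalanced G t (k + 1) → ∀ v : Fin (k + 2) → N,
        Function.Injective v → ∑ i, t (v i) = -((k + 1 : ℕ) * c) := fun h v hv => by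
      rw [h.sum_eq hv 0, hc _ _ (hv.ne (by simp))]
    have ht := eq_of_sum_eq (t := t) (by omega) (hs hk)
    have hcard : ∀ {k}, CyclicallyBalanced G t (k + 1) → k + 2 ≤ Fintype.card N → ∀ x,
        (k + 2) * t x = -((k + 1) * c) := fun {k} h hkN x => by
      obtain ⟨z, hz, -⟩ := exists_injective_extension (Nat.zero_le _) hkN (Fin.elim0 : _ → N)
        (Function.injective_of_subsingleton _)
      have := hs h z hz
      rw [sum_congr rfl fun i _ => ht (z i) x] at this
      simpa using this
    have hc0 : ∀ x : N, c = 0 ∧ t x = 0 := fun x => by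
      have e1 := hcard hk (by omega) x
      have e2 := hcard hl (by omega) x
      push_cast at e2
      have hne : (l + 1 - k : ℝ) ≠ 0 := by
        have : (k : ℝ) < l + 1 := by exact_mod_cast (by omega : k < l + 1)
        linarith
      have hc : c = 0 := by
        refine (mul_eq_zero.1 (?_ : (l + 1 - k : ℝ) * c = 0)).resolve_left hne
        linear_combination (k + 2 : ℝ) * e2 - (l + 1 + 2 : ℝ) * e1
      refine ⟨hc, ?_⟩
      rw [hc, mul_zero, neg_zero] at e1
      exact (mul_eq_zero.1 e1).resolve_left (by positivity)
    exact ⟨fun x => (hc0 x).2, fun u v huv => (hc _ _ huv).trans (hc0 u).1⟩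

end CyclicallyBalanced

/-- The arcs of the closed walk through the nodes `g 0, …, g (k + 1)`. -/
def cycleArcs {V : Type*} [DecidableEq V] {k : ℕ} (g : Fin (k + 2) → V) : Finset (V × V) :=
  univ.image fun i => (g i, g (i + 1))

/-- The arcs of the closed walk `g`, with the arc leaving `n` made to leave `0` instead. -/
def pathArcs (n : ℕ) {k : ℕ} (g : Fin (k + 2) → Fin (n + 1)) :
    Finset (Fin (n + 1) × Fin (n + 1)) :=
  univ.image fun i => (Equiv.swap 0 (Fin.last n) (g i), g (i + 1))

/-- A sequence of distinct nodes of `{1, …, n}` that starts at `n`. -/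
structure IsRooted (n : ℕ) {k : ℕ} (g : Fin (k + 2) → Fin (n + 1)) : Prop where
  injective : Function.Injective g
  zero : g 0 = Fin.last n
  ne_zero : ∀ i, g i ≠ 0

theorem sum_cycleArcs {V : Type*} [DecidableEq V] {k : ℕ} {g : Fin (k + 2) → V}
    (hg : Function.Injective g) (w : V × V → ℝ) :
    ∑ a ∈ cycleArcs g, w a = ∑ i, w (g i, g (i + 1)) :=
  sum_image fun _ _ _ _ h => hg (congrArg Prod.fst h)

theorem card_cycleArcs {V : Type*} [DecidableEq V] {k : ℕ} {g : Fin (k + 2) → V}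
    (hg : Function.Injective g) : (cycleArcs g).card = k + 2 := by
  rw [cycleArcs, card_image_of_injective _ fun _ _ h => hg (congrArg Prod.fst h)]
  simp

section Rooted

variable {n k : ℕ} {g : Fin (k + 2) → Fin (n + 1)}

theorem IsRooted.ne_last (hg : IsRooted n g) {i : Fin (k + 2)} (hi : i ≠ 0) :
    g i ≠ Fin.last n := fun h => hi (hg.injective (h.trans hg.zero.symm))

theorem IsRooted.swap_zero (hg : IsRooted n g) : Equiv.swap 0 (Fin.last n) (g 0) = 0 := by
  rw [hg.zero, Equiv.swap_apply_right]

theorem IsRooted.swap_of_ne (hg : IsRooted n g) {i : Fin (k + 2)} (hi : i ≠ 0) :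
    Equiv.swap 0 (Fin.last n) (g i) = g i :=
  Equiv.swap_apply_of_ne_of_ne (hg.ne_zero i) (hg.ne_last hi)

theorem sum_pathArcs (hg : Function.Injective g) (w : Fin (n + 1) × Fin (n + 1) → ℝ) :
    ∑ a ∈ pathArcs n g, w a = ∑ i, w (Equiv.swap 0 (Fin.last n) (g i), g (i + 1)) :=
  sum_image fun _ _ _ _ h => hg ((Equiv.swap _ _).injective (congrArg Prod.fst h))

theorem card_pathArcs (hg : Function.Injective g) : (pathArcs n g).card = k + 2 := by
  rw [pathArcs, card_image_of_injective _ fun _ _ h =>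
    hg ((Equiv.swap _ _).injective (congrArg Prod.fst h))]
  simp

theorem IsRooted.pathArcs_subset (hg : IsRooted n g) : pathArcs n g ⊆ tA n := by
  have hn : (0 : Fin (n + 1)) ≠ Fin.last n := fun h => hg.ne_zero 0 (hg.zero.trans h.symm)
  intro a ha
  obtain ⟨i, -, rfl⟩ := mem_image.1 ha
  simp only [tA, mem_filter, mem_univ, true_and]
  refine ⟨?_, hg.ne_zero _, ?_, ?_⟩
  · by_cases hi : i = 0
    · rw [hi, hg.swap_zero]
      exact (hg.ne_zero _).symm
    · rw [hg.swap_of_ne hi]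
      exact hg.injective.ne (by simp)
  · by_cases hi : i = 0
    · rwa [hi, hg.swap_zero]
    · rw [hg.swap_of_ne hi]
      exact hg.ne_last hi
  · rintro ⟨h1, h2⟩
    by_cases hi : i = 0
    · subst hi
      exact hg.ne_last (by simp) h2
    · rw [hg.swap_of_ne hi] at h1
      exact hg.ne_zero _ h1

theorem IsRooted.isTildePath (hg : IsRooted n g) : IsTildePath n (pathArcs n g) := by
  refine ⟨hg.pathArcs_subset, k + 2,
    Fin.snoc (α := fun _ => Fin (n + 1)) (fun i => Equiv.swap 0 (Fin.last n) (g i)) (Fin.last n),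
    ?_, ?_, ?_, ?_⟩
  · rw [Fin.snoc_injective_iff]
    refine ⟨(Equiv.swap _ _).injective.comp hg.injective, ?_⟩
    rintro ⟨i, hi⟩
    rw [Equiv.swap_apply_eq_iff, Equiv.swap_apply_right] at hi
    exact hg.ne_zero i hi
  · exact (Fin.snoc_castSucc (α := fun _ => Fin (n + 1)) _ _ 0).trans hg.swap_zero
  · rw [Fin.snoc_last]
  · refine image_congr fun i _ => ?_
    rw [Fin.snoc_castSucc]
    congr 1
    induction i using Fin.lastCases with
    | last => rw [Fin.succ_last, Fin.snoc_last, Fin.last_add_one, hg.zero]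
    | cast i =>
      rw [Fin.succ_castSucc, Fin.snoc_castSucc, Fin.coeSucc_eq_succ,
        hg.swap_of_ne (Fin.succ_ne_zero i)]

end Rooted

theorem IsTildePath.exists_rooted {n : ℕ} {P : Finset (Fin (n + 1) × Fin (n + 1))}
    (hP : IsTildePath n P) (h2 : 2 ≤ P.card) :
    ∃ (k : ℕ) (g : Fin (k + 2) → Fin (n + 1)), IsRooted n g ∧ P = pathArcs n g := by
  obtain ⟨-, k, f, hf, hf0, hfl, rfl⟩ := hP
  rw [card_image_of_injective _ fun _ _ h =>
    Fin.castSucc_injective _ (hf (congrArg Prod.fst h)), card_univ, Fintype.card_fin] at h2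
  obtain ⟨k, rfl⟩ : ∃ k', k = k' + 2 := ⟨k - 2, by omega⟩
  have hg : IsRooted n fun i : Fin (k + 2) => Equiv.swap 0 (Fin.last n) (f i.castSucc) := by
    refine ⟨(Equiv.swap _ _).injective.comp (hf.comp (Fin.castSucc_injective _)), ?_, fun i h => ?_⟩
    · rw [Fin.castSucc_zero, hf0, Equiv.swap_apply_left]
    · rw [Equiv.swap_apply_eq_iff, Equiv.swap_apply_left, ← hfl] at h
      exact Fin.castSucc_ne_last i (hf h)
  refine ⟨k, _, hg, image_congr fun i _ => ?_⟩
  dsimp only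
  rw [Equiv.swap_apply_self]
  congr 1
  induction i using Fin.lastCases with
  | last => rw [Fin.succ_last, Fin.last_add_one, hfl, hg.zero]
  | cast i =>
    rw [← hg.swap_of_ne (i := i.castSucc + 1) (by simp [Fin.coeSucc_eq_succ]),
      Equiv.swap_apply_self, Fin.coeSucc_eq_succ, Fin.succ_castSucc]

theorem exists_rooted_of_apply_eq_last {n k : ℕ} {f : Fin (k + 2) → Fin (n + 1)}
    (hf : Function.Injective f) (h0 : ∀ i, f i ≠ 0) {r : Fin (k + 2)} (hr : f r = Fin.last n) :
    ∃ g : Fin (k + 2) → Fin (n + 1), IsRooted n g ∧ cycleArcs f = cycleArcs g := by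
  refine ⟨fun i => f (r + i), ⟨hf.comp (add_right_injective r), by simpa using hr,
    fun i => h0 _⟩, ?_⟩
  ext a
  simp only [cycleArcs, mem_image, mem_univ, true_and]
  constructor
  · rintro ⟨i, rfl⟩
    exact ⟨i - r, by simp [add_sub_cancel, ← add_assoc]⟩
  · rintro ⟨i, rfl⟩
    exact ⟨r + i, by rw [add_assoc]⟩

/-- Identifying the end nodes `0` and `n` of a path: the rows `0` and `n` are exchanged. -/
noncomputable def swapRows (n : ℕ) :
    (Fin (n + 1) → Fin (n + 1) → ℝ) ≃ₗ[ℝ] (Fin (n + 1) → Fin (n + 1) → ℝ) :=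
  LinearEquiv.funCongrLeft ℝ (Fin (n + 1) → ℝ) (Equiv.swap 0 (Fin.last n))

theorem swapRows_incVec {n k : ℕ} (g : Fin (k + 2) → Fin (n + 1)) :
    swapRows n (incVec (pathArcs n g)) = incVec (cycleArcs g) := by
  ext i j
  simp [swapRows, LinearEquiv.funCongrLeft_apply, LinearMap.funLeft_apply, incVec, pathArcs,
    cycleArcs]

/-- The linear functional with coefficient `β i j` on the arc `(i, j)`. -/
noncomputable def arcFunctional {N : ℕ} (β : Fin N → Fin N → ℝ) : (Fin N → Fin N → ℝ) →ₗ[ℝ] ℝ :=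
  ∑ i, ∑ j, β i j •
    (LinearMap.proj (R := ℝ) (φ := fun _ => ℝ) j ∘ₗ LinearMap.proj (φ := fun _ => Fin N → ℝ) i)

theorem arcFunctional_apply {N : ℕ} (β x : Fin N → Fin N → ℝ) :
    arcFunctional β x = ∑ i, ∑ j, β i j * x i j := by
  simp [arcFunctional, LinearMap.sum_apply]

theorem arcFunctional_incVec {N : ℕ} (β : Fin N → Fin N → ℝ) (C : Finset (Fin N × Fin N)) :
    arcFunctional β (incVec C) = ∑ a ∈ C, β a.1 a.2 := by
  rw [arcFunctional_apply, ← Fintype.sum_prod_type' (f := fun i j => β i j * incVec C i j)]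
  simp [incVec]

theorem exists_eq_arcFunctional {N : ℕ} (φ : (Fin N → Fin N → ℝ) →ₗ[ℝ] ℝ) :
    ∃ β, φ = arcFunctional β := by
  refine ⟨fun i j => φ (Pi.single i (Pi.single j 1)), ?_⟩
  refine LinearMap.pi_ext' fun i => LinearMap.pi_ext' fun j => ?_
  ext
  simp [arcFunctional_apply, Pi.single_apply, ite_apply, apply_ite]

/-- The internal nodes `1, …, n - 1`. -/
abbrev InternalNode (n : ℕ) : Type := {i : Fin (n + 1) // i ≠ 0 ∧ i ≠ Fin.last n}

theorem card_internalNode {n : ℕ} (hn : 0 < n) : Fintype.card (InternalNode n) = n - 1 := by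
  have h : (Fin.last n) ≠ 0 := by simp [Fin.ext_iff, hn.ne']
  have : (univ.filter fun i : Fin (n + 1) => i ≠ 0 ∧ i ≠ Fin.last n) =
      (univ.erase 0).erase (Fin.last n) := by
    ext i
    simp [and_comm]
  rw [Fintype.card_subtype, this, card_erase_of_mem (by simpa using h),
    card_erase_of_mem (mem_univ _)]
  simp

theorem isRooted_cons {n k : ℕ} (hn : 0 < n) {v : Fin (k + 1) → InternalNode n}
    (hv : Function.Injective v) :
    IsRooted n (Fin.cons (Fin.last n) fun i => (v i : Fin (n + 1)) :
      Fin (k + 2) → Fin (n + 1)) := by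
  refine ⟨?_, by simp, fun i => ?_⟩
  · rw [Fin.cons_injective_iff]
    refine ⟨?_, Subtype.val_injective.comp hv⟩
    rintro ⟨i, hi⟩
    exact (v i).2.2 hi
  · induction i using Fin.cases with
    | zero => simp [Fin.ext_iff, hn.ne']
    | succ i => simpa using (v i).2.1

theorem exists_isRooted {n k : ℕ} (hk : k + 2 ≤ n) (u : InternalNode n) :
    ∃ g : Fin (k + 2) → Fin (n + 1), IsRooted n g ∧ g 1 = u := by
  obtain ⟨v, hv, hvu⟩ := exists_injective_extension (j := 1) (k := k + 1) (by omega)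
    (by rw [card_internalNode (by omega)]; omega) (fun _ => u)
    (Function.injective_of_subsingleton _)
  refine ⟨_, isRooted_cons (by omega) hv, ?_⟩
  rw [← Fin.succ_zero_eq_one, Fin.cons_succ]
  exact congrArg Subtype.val (hvu 0)

theorem sum_comp_add_one {k : ℕ} (w : Fin (k + 1) → ℝ) : ∑ i, w (i + 1) = ∑ i, w i :=
  Equiv.sum_comp (Equiv.addRight 1) w

/-- If all closed walks on `k + 2` nodes through `n` have the same weight, then the defect of the
weight from being a difference of node potentials is cyclically balanced. -/
theorem cyclicallyBalanced_of_sum_eq {n k : ℕ} (hn : 0 < n) {β : Fin (n + 1) → Fin (n + 1) → ℝ}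
    {s : ℝ} (h : ∀ g : Fin (k + 2) → Fin (n + 1), IsRooted n g → ∑ i, β (g i) (g (i + 1)) = s) :
    CyclicallyBalanced (N := InternalNode n)
      (fun u v => β u v - β u (Fin.last n) - β (Fin.last n) v + s)
      (fun u => β (Fin.last n) u + β u (Fin.last n) - s) k := by
  intro v hv r'
  obtain ⟨r, rfl⟩ : ∃ r, r' = r + Fin.last k := ⟨r' - Fin.last k, by simp⟩
  have hr : r + Fin.last k + 1 = r := by rw [add_assoc, Fin.last_add_one, add_zero]
  have hs := h _ (isRooted_cons hn (hv.comp (add_right_injective r)))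
  rw [Fin.sum_univ_succ, Fin.sum_univ_castSucc] at hs
  have hsum : ∑ i, (β (v i) (v (i + 1)) - β (v i) (Fin.last n) - β (Fin.last n) (v (i + 1)) + s +
      (β (Fin.last n) (v i) + β (v i) (Fin.last n) - s)) = ∑ i, β (v i) (v (i + 1)) := by
    have := sum_comp_add_one fun i => β (Fin.last n) (v i)
    rw [← sub_eq_zero, ← sum_sub_distrib] at this ⊢
    rw [← neg_eq_zero, ← sum_neg_distrib, ← this]
    exact sum_congr rfl fun i _ => by ring
  dsimp only
  rw [hsum, ← Equiv.sum_comp (Equiv.addLeft r), Fin.sum_univ_castSucc]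
  simp only [Equiv.coe_addLeft, hr, add_assoc, Fin.coeSucc_eq_succ]
  have e0 : (0 : Fin (k + 2)) + 1 = Fin.succ 0 := by simp
  have e1 : ∀ i : Fin k, i.castSucc.succ + 1 = i.succ.succ := fun i => by
    rw [Fin.succ_castSucc, Fin.coeSucc_eq_succ]
  have e2 : (Fin.last k).succ + 1 = 0 := by rw [Fin.succ_last, Fin.last_add_one]
  simp only [e0, e1, e2, Fin.cons_zero, Fin.cons_succ, Function.comp_apply, add_zero] at hs
  linarith

theorem exists_potential {n k l : ℕ} (hkl : k < l) (hl : l + 2 ≤ n)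
    {β : Fin (n + 1) → Fin (n + 1) → ℝ} {s : ℝ}
    (hk : ∀ g : Fin (k + 2) → Fin (n + 1), IsRooted n g → ∑ i, β (g i) (g (i + 1)) = s)
    (hl : ∀ g : Fin (l + 2) → Fin (n + 1), IsRooted n g → ∑ i, β (g i) (g (i + 1)) = s) :
    ∃ π : Fin (n + 1) → ℝ, (∀ u v, u ≠ 0 → v ≠ 0 → u ≠ v →
      β u v = π u - π v + if u = Fin.last n then s else 0) := by
  obtain ⟨ht, hG⟩ := (cyclicallyBalanced_of_sum_eq (by omega) hk).eq_zero
    (cyclicallyBalanced_of_sum_eq (by omega) hl) hkl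
    (by rw [card_internalNode (by omega)]; omega)
  refine ⟨fun i => if i = Fin.last n then 0 else β i (Fin.last n), fun u v hu hv huv => ?_⟩
  by_cases hun : u = Fin.last n
  · have := ht ⟨v, hv, fun h => huv (hun.trans h.symm)⟩
    simp [hun, (hun ▸ huv).symm]
    linarith
  · by_cases hvn : v = Fin.last n
    · simp [hun, hvn]
    · have h1 := ht ⟨v, hv, hvn⟩
      have h2 := hG ⟨u, hu, hun⟩ ⟨v, hv, hvn⟩ (by simpa using huv)
      simp [hun, hvn]
      linarith

theorem vectorSpan_le_ker {V : Type*} [AddCommGroup V] [Module ℝ V] {s : Set V} {φ : V →ₗ[ℝ] ℝ}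
    {r : ℝ} (h : ∀ x ∈ s, φ x = r) : vectorSpan ℝ s ≤ LinearMap.ker φ := by
  rw [vectorSpan_def, Submodule.span_le]
  rintro _ ⟨x, hx, y, hy, rfl⟩
  simp [h x hx, h y hy]

section Polytopes

variable {n m : ℕ} {c : Fin m → ℕ}

theorem incVec_pathArcs_mem {k : ℕ} {g : Fin (k + 2) → Fin (n + 1)} (hg : IsRooted n g) {p : Fin m}
    (hp : k + 2 = c p) : incVec (pathArcs n g) ∈ pathPolytope n c :=
  subset_convexHull _ _ ⟨_, hg.isTildePath, ⟨p, by rw [card_pathArcs hg.injective, hp]⟩, rfl⟩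

theorem pathPolytope_subset (hc2 : ∀ p, 2 ≤ c p) {S : Set (Fin (n + 1) → Fin (n + 1) → ℝ)}
    (hS : Convex ℝ S) (h : ∀ (k : ℕ) (g : Fin (k + 2) → Fin (n + 1)) (p : Fin m), IsRooted n g →
      k + 2 = c p → incVec (pathArcs n g) ∈ S) : pathPolytope n c ⊆ S := by
  refine convexHull_min ?_ hS
  rintro _ ⟨P, hP, ⟨p, hp⟩, rfl⟩
  obtain ⟨k, g, hg, rfl⟩ := hP.exists_rooted (hp ▸ hc2 p)
  exact h k g p hg (by rw [← hp, card_pathArcs hg.injective])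

theorem incVec_cycleArcs_mem {k : ℕ} {f : Fin (k + 2) → Fin (n + 1)} (hf : Function.Injective f)
    (h0 : ∀ i, f i ≠ 0) {p : Fin m} (hp : k + 2 = c p) :
    incVec (cycleArcs f) ∈ cyclePolytopeOn n c := by
  refine subset_convexHull _ _ ⟨_, ⟨k, f, hf, rfl⟩, fun a ha => ?_, ⟨p, ?_⟩, rfl⟩
  · obtain ⟨i, -, rfl⟩ := mem_image.1 ha
    exact ⟨h0 _, h0 _⟩
  · exact (card_cycleArcs hf).trans hp

theorem cyclePolytopeOn_subset {S : Set (Fin (n + 1) → Fin (n + 1) → ℝ)}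
    (hS : Convex ℝ S) (h : ∀ (k : ℕ) (f : Fin (k + 2) → Fin (n + 1)) (p : Fin m),
      Function.Injective f → (∀ i, f i ≠ 0) → k + 2 = c p → incVec (cycleArcs f) ∈ S) :
    cyclePolytopeOn n c ⊆ S := by
  refine convexHull_min ?_ hS
  rintro _ ⟨_, ⟨k, f, hf, rfl⟩, hC, ⟨p, hp⟩, rfl⟩
  exact h k f p hf (fun i => (hC _ (mem_image_of_mem _ (mem_univ i))).1)
    ((card_cycleArcs hf).symm.trans hp)

theorem swapRows_mem (hc2 : ∀ p, 2 ≤ c p) {y : Fin (n + 1) → Fin (n + 1) → ℝ}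
    (hy : y ∈ pathPolytope n c) : swapRows n y ∈ cyclePolytopeOn n c := by
  refine pathPolytope_subset (S := (swapRows n).toLinearMap ⁻¹' cyclePolytopeOn n c) hc2
    ((convex_convexHull ℝ _).linear_preimage _) (fun k g p hg hp => ?_) hy
  rw [Set.mem_preimage, LinearEquiv.coe_coe, swapRows_incVec]
  exact incVec_cycleArcs_mem hg.injective hg.ne_zero hp

theorem one_lt_adim_pathPolytope {p q : Fin m} (hpq : c p ≠ c q) (hp2 : 2 ≤ c p) (hq2 : 2 ≤ c q)
    (hpn : c p ≤ n) (hqn : c q ≤ n) (hn : 3 ≤ n) : 1 < adim (pathPolytope n c) := by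
  obtain ⟨k, hk⟩ := Nat.exists_eq_add_of_le' hp2
  obtain ⟨l, hl⟩ := Nat.exists_eq_add_of_le' hq2
  obtain ⟨u, v, huv⟩ := Fintype.exists_pair_of_one_lt_card
    (α := InternalNode n) (by rw [card_internalNode (by omega)]; omega)
  obtain ⟨g, hg, hgu⟩ := exists_isRooted (by omega : k + 2 ≤ n) u
  obtain ⟨g', hg', hgv⟩ := exists_isRooted (by omega : k + 2 ≤ n) v
  obtain ⟨f, hf, -⟩ := exists_isRooted (by omega : l + 2 ≤ n) u
  have hgm := incVec_pathArcs_mem hg hk.symm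
  have hgm' := incVec_pathArcs_mem hg' hk.symm
  have hfm := incVec_pathArcs_mem hf hl.symm
  set d := incVec (pathArcs n g) - incVec (pathArcs n g')
  have hd : d ≠ 0 := fun h => by
    have h1 : (0, (u : Fin (n + 1))) ∈ pathArcs n g :=
      mem_image.2 ⟨0, mem_univ _, by rw [hg.swap_zero, zero_add, hgu]⟩
    have h2 : (0, (u : Fin (n + 1))) ∉ pathArcs n g' := fun h => by
      obtain ⟨i, -, hi⟩ := mem_image.1 h
      obtain ⟨hi1, hi2⟩ := Prod.ext_iff.1 hi
      by_cases hi0 : i = 0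
      · simp only [hi0, zero_add, hgv] at hi2
        exact huv (Subtype.ext hi2.symm)
      · exact hg'.ne_zero i ((hg'.swap_of_ne hi0).symm.trans hi1)
    have := congrFun (congrFun h 0) u
    simp [d, incVec, h1, h2] at this
  have hφ : ∀ P : Finset (Fin (n + 1) × Fin (n + 1)),
      arcFunctional (fun _ _ => 1) (incVec P) = P.card := fun P => by
    simp [arcFunctional_incVec]
  have hlt : Submodule.span ℝ {d} < vectorSpan ℝ (pathPolytope n c) := by
    refine lt_of_le_of_ne ?_ fun h => ?_
    · rw [Submodule.span_singleton_le_iff_mem]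
      exact vsub_mem_vectorSpan ℝ hgm hgm'
    · have hmem := vsub_mem_vectorSpan ℝ hgm hfm
      rw [← h] at hmem
      have hle : Submodule.span ℝ {d} ≤ LinearMap.ker (arcFunctional fun _ _ => 1) := by
        rw [Submodule.span_singleton_le_iff_mem, LinearMap.mem_ker, map_sub, hφ, hφ,
          card_pathArcs hg.injective, card_pathArcs hg'.injective, sub_self]
      have := hle hmem
      rw [LinearMap.mem_ker, vsub_eq_sub, map_sub, hφ, hφ, card_pathArcs hg.injective,
        card_pathArcs hf.injective, sub_eq_zero, Nat.cast_inj] at this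
      omega
  have := Submodule.finrank_lt_finrank_of_lt hlt
  rwa [finrank_span_singleton hd] at this

/-- The cycle polytope has at most one more dimension than the path polytope: it is spanned by
the cycles through `n`, which are paths, and any one cycle `f` that avoids `n`. -/
theorem adim_cyclePolytopeOn_le (hc2 : ∀ p, 2 ≤ c p) {p q : Fin m} (hpq : c p < c q)
    (hqn : c q ≤ n) {j : ℕ} {f : Fin (j + 2) → Fin (n + 1)} (hf : Function.Injective f)
    (h0 : ∀ i, f i ≠ 0) (hl : ∀ i, f i ≠ Fin.last n) :
    adim (cyclePolytopeOn n c) ≤ adim (pathPolytope n c) + 1 := by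
  obtain ⟨k, hk⟩ := Nat.exists_eq_add_of_le' (hc2 p)
  obtain ⟨l, hl'⟩ := Nat.exists_eq_add_of_le' (hc2 q)
  obtain ⟨u⟩ := Fintype.card_pos_iff.1
    (show 0 < Fintype.card (InternalNode n) by rw [card_internalNode (by omega)]; omega)
  obtain ⟨g₀, hg₀, -⟩ := exists_isRooted (by omega : k + 2 ≤ n) u
  set d := incVec (cycleArcs f) - incVec (cycleArcs g₀) with hd
  have hle : vectorSpan ℝ (cyclePolytopeOn n c) ≤
      (vectorSpan ℝ (pathPolytope n c)).map (swapRows n).toLinearMap ⊔ Submodule.span ℝ {d} := by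
    intro x hx
    by_contra hxn
    obtain ⟨φ, hφx, hφ⟩ := Submodule.exists_le_ker_of_notMem hxn
    obtain ⟨β, rfl⟩ := exists_eq_arcFunctional φ
    set s := arcFunctional β (incVec (cycleArcs g₀)) with hs
    have hpath : ∀ (k : ℕ) (g : Fin (k + 2) → Fin (n + 1)) (p : Fin m), IsRooted n g →
        k + 2 = c p → ∑ i, β (g i) (g (i + 1)) = s := fun k' g p' hg hp' => by
      have hmem := hφ (Submodule.mem_sup_left (Submodule.mem_map_of_mem
        (vsub_mem_vectorSpan ℝ (incVec_pathArcs_mem hg hp') (incVec_pathArcs_mem hg₀ hk.symm))))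
      rw [LinearMap.mem_ker, LinearEquiv.coe_coe, vsub_eq_sub, map_sub, swapRows_incVec,
        swapRows_incVec, map_sub, sub_eq_zero, arcFunctional_incVec,
        sum_cycleArcs hg.injective] at hmem
      exact hmem
    obtain ⟨π, hπ⟩ := exists_potential (by omega : k < l) (by omega)
      (fun g hg => hpath k g p hg hk.symm) (fun g hg => hpath l g q hg hl'.symm)
    have hsum : ∀ {k : ℕ} {g : Fin (k + 2) → Fin (n + 1)}, Function.Injective g →
        (∀ i, g i ≠ 0) → arcFunctional β (incVec (cycleArcs g)) =
          ∑ i, if g i = Fin.last n then s else 0 := fun {k g} hg hg0 => by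
      rw [arcFunctional_incVec, sum_cycleArcs hg,
        sum_congr rfl fun i _ => hπ _ _ (hg0 i) (hg0 (i + 1)) (hg.ne (by simp)),
        sum_add_distrib, sum_sub_distrib, sum_comp_add_one fun i => π (g i),
        sub_self, zero_add]
    have hs0 : s = 0 := by
      have hmem := hφ (Submodule.mem_sup_right (Submodule.mem_span_singleton_self d))
      rw [LinearMap.mem_ker, hd, map_sub, hsum hf h0] at hmem
      simpa [hl, ← hs] using hmem
    refine hφx (vectorSpan_le_ker (r := 0) (fun y hy => ?_) hx)
    refine cyclePolytopeOn_subset (convex_hyperplane (arcFunctional β).isLinear 0)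
      (fun k g p hg hg0 _ => ?_) hy
    simp [hsum hg hg0, hs0]
  have h1 := Submodule.finrank_mono hle
  have h2 := Submodule.finrank_add_le_finrank_add_finrank
    ((vectorSpan ℝ (pathPolytope n c)).map (swapRows n).toLinearMap) (Submodule.span ℝ {d})
  have h3 : Module.finrank ℝ (Submodule.span ℝ {d}) ≤ 1 :=
    (finrank_span_le_card _).trans (by simp)
  have h4 := LinearEquiv.finrank_map_eq (swapRows n) (vectorSpan ℝ (pathPolytope n c))
  unfold adim
  omega

end Polytopes

/-- The coefficients of the lifted inequality, with `δ` added on the arcs leaving `n`. -/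
noncomputable def liftCoeff (n : ℕ) (α : Fin (n + 1) → Fin (n + 1) → ℝ) (δ : ℝ) :
    Fin (n + 1) → Fin (n + 1) → ℝ := fun i j =>
  if i ≠ 0 ∧ j ≠ 0 ∧ i ≠ j then
    α (Equiv.swap 0 (Fin.last n) i) j + (if i = Fin.last n then δ else 0)
  else 0

theorem liftCoeff_of_ne {n : ℕ} {α : Fin (n + 1) → Fin (n + 1) → ℝ} {δ : ℝ} {i j : Fin (n + 1)}
    (hi : i ≠ 0) (hj : j ≠ 0) (hij : i ≠ j) : liftCoeff n α δ i j =
      α (Equiv.swap 0 (Fin.last n) i) j + (if i = Fin.last n then δ else 0) :=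
  if_pos ⟨hi, hj, hij⟩

theorem arcFunctional_liftCoeff_apply {n : ℕ} (hn : Fin.last n ≠ 0)
    (α : Fin (n + 1) → Fin (n + 1) → ℝ) (δ : ℝ) (x : Fin (n + 1) → Fin (n + 1) → ℝ) :
    arcFunctional (liftCoeff n α δ) x =
      (∑ i ∈ univ.erase (0 : Fin (n + 1)), ∑ j ∈ (univ.erase (0 : Fin (n + 1))).erase i,
        (if i = Fin.last n then α 0 j else α i j) * x i j)
      + δ * ∑ j ∈ (univ.erase (0 : Fin (n + 1))).erase (Fin.last n), x (Fin.last n) j := by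
  have hδ : δ * ∑ j ∈ (univ.erase (0 : Fin (n + 1))).erase (Fin.last n), x (Fin.last n) j =
      ∑ i ∈ univ.erase (0 : Fin (n + 1)), ∑ j ∈ (univ.erase (0 : Fin (n + 1))).erase i,
        (if i = Fin.last n then δ else 0) * x i j := by
    symm
    refine (sum_eq_single_of_mem (Fin.last n) (mem_erase.2 ⟨hn, mem_univ _⟩)
      fun i _ hi => by simp [hi]).trans ?_
    simp [mul_sum]
  rw [hδ, ← sum_add_distrib, arcFunctional_apply, eq_comm]
  have hrow : ∀ i ∈ univ.erase (0 : Fin (n + 1)),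
      ((∑ j ∈ (univ.erase (0 : Fin (n + 1))).erase i,
        (if i = Fin.last n then α 0 j else α i j) * x i j) +
      ∑ j ∈ (univ.erase (0 : Fin (n + 1))).erase i, (if i = Fin.last n then δ else 0) * x i j) =
      ∑ j, liftCoeff n α δ i j * x i j := by
    intro i hi
    rw [← sum_add_distrib]
    have hi0 : i ≠ 0 := ne_of_mem_erase hi
    refine (sum_congr rfl fun j hj => ?_).trans (sum_subset (subset_univ _) fun j _ hj => ?_)
    · rw [mem_erase, mem_erase] at hj
      rw [liftCoeff_of_ne hi0 hj.2.1 hj.1.symm, ← add_mul]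
      by_cases hil : i = Fin.last n
      · simp [hil]
      · simp [hil, Equiv.swap_apply_of_ne_of_ne hi0 hil]
    · rw [liftCoeff, if_neg, zero_mul]
      simp only [mem_erase, mem_univ, and_true, not_and, not_not] at hj
      rintro ⟨-, h1, h2⟩
      exact h1 (hj h2.symm)
  rw [sum_congr rfl hrow]
  refine sum_subset (subset_univ _) fun i _ hi => sum_eq_zero fun j _ => ?_
  have : i = 0 := by simpa using hi
  simp [liftCoeff, this]

theorem arcFunctional_liftCoeff_incVec {n k : ℕ} {α : Fin (n + 1) → Fin (n + 1) → ℝ} {δ : ℝ}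
    {f : Fin (k + 2) → Fin (n + 1)} (hf : Function.Injective f) (h0 : ∀ i, f i ≠ 0) :
    arcFunctional (liftCoeff n α δ) (incVec (cycleArcs f)) =
      ∑ i, α (Equiv.swap 0 (Fin.last n) (f i)) (f (i + 1)) +
        ∑ i, if f i = Fin.last n then δ else 0 := by
  rw [arcFunctional_incVec, sum_cycleArcs hf, ← sum_add_distrib]
  exact sum_congr rfl fun i _ => liftCoeff_of_ne (h0 _) (h0 _) (hf.ne (by simp))

theorem IsRooted.arcFunctional_liftCoeff {n k : ℕ} {α : Fin (n + 1) → Fin (n + 1) → ℝ} {δ : ℝ}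
    {g : Fin (k + 2) → Fin (n + 1)} (hg : IsRooted n g) :
    arcFunctional (liftCoeff n α δ) (incVec (cycleArcs g)) =
      ∑ a ∈ tA n, α a.1 a.2 * incVec (pathArcs n g) a.1 a.2 + δ := by
  have h1 : ∑ a ∈ tA n, α a.1 a.2 * incVec (pathArcs n g) a.1 a.2 =
      ∑ a ∈ pathArcs n g, α a.1 a.2 := by
    simp [incVec, inter_eq_right.2 hg.pathArcs_subset]
  have h2 : ∀ i, g i = Fin.last n ↔ i = 0 := fun i => by rw [← hg.zero, hg.injective.eq_iff]
  rw [arcFunctional_liftCoeff_incVec hg.injective hg.ne_zero, h1, sum_pathArcs hg.injective]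
  simp [h2]

theorem arcFunctional_liftCoeff_swapRows {n m : ℕ} {c : Fin m → ℕ} (hc2 : ∀ p, 2 ≤ c p)
    {α : Fin (n + 1) → Fin (n + 1) → ℝ} {δ : ℝ} {y : Fin (n + 1) → Fin (n + 1) → ℝ}
    (hy : y ∈ pathPolytope n c) : arcFunctional (liftCoeff n α δ) (swapRows n y) =
      ∑ a ∈ tA n, α a.1 a.2 * y a.1 a.2 + δ := by
  set φ : (Fin (n + 1) → Fin (n + 1) → ℝ) →ₗ[ℝ] ℝ :=
    arcFunctional (liftCoeff n α δ) ∘ₗ (swapRows n).toLinearMap -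
      arcFunctional fun i j => if (i, j) ∈ tA n then α i j else 0
  have hφ : ∀ x, φ x = arcFunctional (liftCoeff n α δ) (swapRows n x) -
      ∑ a ∈ tA n, α a.1 a.2 * x a.1 a.2 := fun x => by
    simp only [φ, LinearMap.sub_apply, LinearMap.comp_apply, LinearEquiv.coe_coe]
    rw [arcFunctional_apply (fun i j => if (i, j) ∈ tA n then α i j else 0),
      ← Fintype.sum_prod_type' (f := fun i j => (if (i, j) ∈ tA n then α i j else 0) * x i j)]
    simp
  have : φ y = δ := pathPolytope_subset (S := {x | φ x = δ}) hc2
    (convex_hyperplane φ.isLinear δ) (fun k g p hg hp => by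
      rw [Set.mem_ofPred_eq, hφ, swapRows_incVec, hg.arcFunctional_liftCoeff,
        add_sub_cancel_left]) hy
  rw [hφ] at this
  linarith

theorem IsSimpleCycle.exists_of_subset_tA {n : ℕ} {C : Finset (Fin (n + 1) × Fin (n + 1))}
    (hC : IsSimpleCycle C) (h : C ⊆ tA n) : ∃ (k : ℕ) (f : Fin (k + 2) → Fin (n + 1)),
      Function.Injective f ∧ C = cycleArcs f ∧ (∀ i, f i ≠ 0) ∧ ∀ i, f i ≠ Fin.last n := by
  obtain ⟨k, f, hf, rfl⟩ := hC
  have hA : ∀ i, (f i, f (i + 1)) ∈ tA n := fun i => h (mem_image_of_mem _ (mem_univ i))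
  simp only [tA, mem_filter, mem_univ, true_and] at hA
  exact ⟨k, f, hf, rfl, fun i => by simpa using (hA (i - 1)).2.1, fun i => (hA i).2.2.1⟩

/-- **Lifting theorem.**  Let `c` be a cardinality sequence with `m ≥ 2` and
`2 ≤ c 0 < ⋯ < c (m-1) ≤ n`.  Let `α x ≤ α₀` be facet defining for the path polytope
`P_{0,n-path}^c(D̃_n)` and let `γ` be the maximum of `α(C)` over all simple directed
cycles `C` in `D̃_n` of cardinality `c p` for some `p`.  Setting `α_{n i} := α_{0 i}` for
the internal nodes `i`, the lifted inequality
`Σ_{i,j ∈ {1,…,n}, i ≠ j} α_{ij} x_{ij} + (γ − α₀)·x(δ^out(n)) ≤ γ`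
defines a facet of the cycle polytope `P_C^c(D_n)` on the node set `{1,…,n}`. -/
theorem lifting_path_facet_to_cycle_facet (n m : ℕ) (hm : 2 ≤ m)
    (c : Fin m → ℕ) (hmono : StrictMono c)
    (hc2 : ∀ p, 2 ≤ c p) (hcn : ∀ p, c p ≤ n)
    (α : Fin (n + 1) → Fin (n + 1) → ℝ) (α₀ : ℝ)
    (hfacet : IsFacetLE (pathPolytope n c)
      (fun x => ∑ a ∈ tA n, α a.1 a.2 * x a.1 a.2) α₀)
    (γ : ℝ)
    (hγ : IsGreatest {s : ℝ | ∃ C : Finset (Fin (n + 1) × Fin (n + 1)),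
      IsSimpleCycle C ∧ C ⊆ tA n ∧ (∃ p, C.card = c p) ∧ s = ∑ a ∈ C, α a.1 a.2} γ) :
    IsFacetLE (cyclePolytopeOn n c)
      (fun x =>
        (∑ i ∈ Finset.univ.erase (0 : Fin (n + 1)),
          ∑ j ∈ (Finset.univ.erase (0 : Fin (n + 1))).erase i,
            (if i = Fin.last n then α 0 j else α i j) * x i j)
        + (γ - α₀) *
            ∑ j ∈ (Finset.univ.erase (0 : Fin (n + 1))).erase (Fin.last n),
              x (Fin.last n) j)
      γ := by
  have h01 : c ⟨0, by omega⟩ < c ⟨1, by omega⟩ := hmono (by simp)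
  have h0 := hc2 ⟨0, by omega⟩
  have h1 := hcn ⟨1, by omega⟩
  have hlast : Fin.last n ≠ 0 := by simp [Fin.ext_iff]; omega
  obtain ⟨⟨C, hC, hCA, ⟨p, hp⟩, hCγ⟩, hmax⟩ := hγ
  obtain ⟨k, f, hf, rfl, hf0, hfl⟩ := hC.exists_of_subset_tA hCA
  rw [card_cycleArcs hf] at hp
  have havoid : ∀ {k : ℕ} {f : Fin (k + 2) → Fin (n + 1)}, Function.Injective f →
      (∀ i, f i ≠ 0) → (∀ i, f i ≠ Fin.last n) →
      arcFunctional (liftCoeff n α (γ - α₀)) (incVec (cycleArcs f)) =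
        ∑ a ∈ cycleArcs f, α a.1 a.2 := fun {k f} hf hf0 hfl => by
    rw [arcFunctional_liftCoeff_incVec hf hf0, sum_cycleArcs hf]
    simp [hfl, fun i => Equiv.swap_apply_of_ne_of_ne (hf0 i) (hfl i)]
  simp only [← arcFunctional_liftCoeff_apply hlast]
  obtain ⟨hvalid, hdim⟩ := hfacet
  have hlift {y} (hy : y ∈ pathPolytope n c) :=
    arcFunctional_liftCoeff_swapRows hc2 (α := α) (δ := γ - α₀) hy
  refine ⟨fun x hx => ?_, ?_⟩
  · refine cyclePolytopeOn_subset (S := {x | arcFunctional (liftCoeff n α (γ - α₀)) x ≤ γ})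
      (convex_halfSpace_le (LinearMap.isLinear _) γ) (fun j g q hg hg0 hq => ?_) hx
    rw [Set.mem_ofPred_eq]
    by_cases hgl : ∃ r, g r = Fin.last n
    · obtain ⟨r, hr⟩ := hgl
      obtain ⟨g', hg', hgg'⟩ := exists_rooted_of_apply_eq_last hg hg0 hr
      have := hvalid _ (incVec_pathArcs_mem hg' hq)
      rw [hgg', hg'.arcFunctional_liftCoeff]
      linarith
    · push Not at hgl
      rw [havoid hg hg0 hgl]
      refine hmax ⟨_, ⟨j, g, hg, rfl⟩, fun a ha => ?_, ⟨q, (card_cycleArcs hg).trans hq⟩, rfl⟩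
      obtain ⟨i, -, rfl⟩ := mem_image.1 ha
      simp only [tA, mem_filter, mem_univ, true_and]
      exact ⟨hg.ne (by simp), hg0 _, hgl _, fun h => hg0 _ h.1⟩
  · set φ := arcFunctional (liftCoeff n α (γ - α₀))
    set F' := {x ∈ pathPolytope n c | ∑ a ∈ tA n, α a.1 a.2 * x a.1 a.2 = α₀}
    set F := {x ∈ cyclePolytopeOn n c | φ x = γ}
    have hpath := one_lt_adim_pathPolytope h01.ne h0 (hc2 _) (hcn _) h1 (by omega : 3 ≤ n)
    have hcycle := adim_cyclePolytopeOn_le hc2 h01 h1 hf hf0 hfl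
    obtain ⟨y₀, hy₀⟩ : F'.Nonempty := by
      rw [Set.nonempty_iff_ne_empty]
      intro h
      rw [h, adim, vectorSpan_empty, finrank_bot] at hdim
      omega
    have hx₀ : incVec (cycleArcs f) ∈ F :=
      ⟨incVec_cycleArcs_mem hf hf0 hp, by rw [havoid hf hf0 hfl, ← hCγ]⟩
    have hmaps : ∀ y ∈ F', swapRows n y ∈ F := fun y hy =>
      ⟨swapRows_mem hc2 hy.1, by rw [hlift hy.1, hy.2]; ring⟩
    obtain ⟨y₁, hy₁, hy₁α⟩ : ∃ y ∈ pathPolytope n c, ∑ a ∈ tA n, α a.1 a.2 * y a.1 a.2 ≠ α₀ := by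
      by_contra! h
      have : F' = pathPolytope n c := Set.sep_eq_self_iff_mem_true.2 h
      rw [this] at hdim
      omega
    have hlt : vectorSpan ℝ F < vectorSpan ℝ (cyclePolytopeOn n c) := by
      refine lt_of_le_of_ne (vectorSpan_mono ℝ (Set.sep_subset _ _)) fun h => hy₁α ?_
      have hmem := vsub_mem_vectorSpan ℝ (swapRows_mem hc2 hy₁) hx₀.1
      rw [← h] at hmem
      have := vectorSpan_le_ker (fun x hx => hx.2) hmem
      rw [LinearMap.mem_ker, vsub_eq_sub, map_sub, hlift hy₁, hx₀.2] at this
      linarith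
    have hlt' : (vectorSpan ℝ F').map (swapRows n).toLinearMap < vectorSpan ℝ F := by
      refine lt_of_le_of_ne ?_ fun h => ?_
      · rw [vectorSpan_def, Submodule.map_span, Submodule.span_le]
        rintro _ ⟨_, ⟨x, hx, y, hy, rfl⟩, rfl⟩
        simpa using vsub_mem_vectorSpan ℝ (hmaps x hx) (hmaps y hy)
      · have hmem := vsub_mem_vectorSpan ℝ hx₀ (hmaps y₀ hy₀)
        rw [← h] at hmem
        obtain ⟨z, hz, hzx⟩ := hmem
        let ψ : (Fin (n + 1) → Fin (n + 1) → ℝ) →ₗ[ℝ] ℝ :=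
          arcFunctional fun i j => if i = Fin.last n then 1 else 0
        have hψ : ∀ y ∈ F', (ψ ∘ₗ (swapRows n).toLinearMap) y = 1 := fun y hy =>
          pathPolytope_subset (S := {y | (ψ ∘ₗ (swapRows n).toLinearMap) y = 1}) hc2
            (convex_hyperplane (LinearMap.isLinear _) 1) (fun k g q hg _ => by
              have h2 : ∀ i, g i = Fin.last n ↔ i = 0 := fun i => by
                rw [← hg.zero, hg.injective.eq_iff]
              rw [Set.mem_ofPred_eq, LinearMap.comp_apply, LinearEquiv.coe_coe, swapRows_incVec,
                arcFunctional_incVec, sum_cycleArcs hg.injective]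
              simp [h2]) hy.1
        have hψz := vectorSpan_le_ker hψ hz
        have hψ₀ := hψ y₀ hy₀
        rw [LinearMap.mem_ker, LinearMap.comp_apply, hzx, vsub_eq_sub, map_sub] at hψz
        rw [LinearMap.comp_apply] at hψ₀
        have hψf : ψ (incVec (cycleArcs f)) = 0 := by
          rw [arcFunctional_incVec, sum_cycleArcs hf]
          simp [hfl]
        rw [hψf, sub_eq_zero] at hψz
        exact zero_ne_one (hψz.trans hψ₀)
    have e1 := Submodule.finrank_lt_finrank_of_lt hlt
    have e2 := Submodule.finrank_lt_finrank_of_lt hlt'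
    have e3 := LinearEquiv.finrank_map_eq (swapRows n) (vectorSpan ℝ F')
    unfold adim at *
    omega
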